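/- arXiv:1103.4346 — 3 statements merged into one kernel-verified Lean document; each statement's English description precedes it below -/
import Mathlib

section
/- Let w = s_{i₁}⋯s_{i_n} be a reduced expression, let 1 ≤ j₁ < ⋯ < j_k ≤ n, set σ = s_{i_{j₁}}⋯s_{i_{j_k}}, and let Γ be the associated subgroup of (V, +). Then Γ coincides with the subgroup of (V, +) generated by the roots (s_{i_n} s_{i_{n−1}} ⋯ s_{i_{m+1}})(α_{i_m}) for those m ∈ {1, …, n} with m ∉ {j₁, …, j_k}. -/
open scoped RealInnerProductSpace

/-- A finite crystallographic root system `Δ` in a real inner product space `V`, together with a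
choice of positive system `pos ⊆ Δ` and simple roots `α 0, …, α (r-1)`, and the assignment
`refl γ` of the orthogonal reflection in the hyperplane orthogonal to `γ`, viewed as a linear
automorphism of `V`.  The Weyl group is generated inside `V ≃ₗ[ℝ] V` by the reflections. -/
structure RootSystemData (V : Type*) [NormedAddCommGroup V] [InnerProductSpace ℝ V] where
  /-- the set of roots -/
  Δ : Set V
  /-- the set of positive roots -/
  pos : Set V
  /-- the number of simple roots -/
  r : ℕ
  /-- the simple roots -/
  α : Fin r → V
  /-- the reflection `s_γ` associated with a root `γ` -/
  refl : V → (V ≃ₗ[ℝ] V)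
  finite : Δ.Finite
  nonzero : ∀ γ ∈ Δ, γ ≠ 0
  refl_apply : ∀ γ ∈ Δ, ∀ x : V, refl γ x = x - (2 * ⟪x, γ⟫ / ⟪γ, γ⟫) • γ
  refl_maps : ∀ γ ∈ Δ, ∀ β ∈ Δ, refl γ β ∈ Δ
  crystallographic : ∀ γ ∈ Δ, ∀ β ∈ Δ, ∃ n : ℤ, 2 * ⟪β, γ⟫ / ⟪γ, γ⟫ = (n : ℝ)
  reduced : ∀ γ ∈ Δ, ∀ t : ℝ, t • γ ∈ Δ → t = 1 ∨ t = -1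
  pos_subset : pos ⊆ Δ
  pos_partition : ∀ γ ∈ Δ, (γ ∈ pos ↔ ¬(-γ ∈ pos))
  simple_mem_pos : ∀ i, α i ∈ pos
  pos_sum : ∀ γ ∈ pos, ∃ c : Fin r → ℝ, (∀ i, 0 ≤ c i) ∧ γ = ∑ i, c i • α i

namespace RootSystemData

variable {V : Type*} [NormedAddCommGroup V] [InnerProductSpace ℝ V] (R : RootSystemData V)

/-- The simple reflection `s_i = s_{α_i}`. -/
def si (i : Fin R.r) : V ≃ₗ[ℝ] V := R.refl (R.α i)

/-- The length of `w` with respect to the simple reflections: the minimal length of a word in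
the simple reflections whose product is `w`. -/
noncomputable def len (w : V ≃ₗ[ℝ] V) : ℕ :=
  sInf {n | ∃ l : List (Fin R.r), l.length = n ∧ (l.map R.si).prod = w}

/-- `l` is a reduced word for `w`. -/
def IsReducedWordFor (l : List (Fin R.r)) (w : V ≃ₗ[ℝ] V) : Prop :=
  (l.map R.si).prod = w ∧ l.length = R.len w

/-- The Bruhat order: `u ≤ w` iff some reduced word for `u` occurs as a subword of some reduced
word for `w`. -/
def BruhatLE (u w : V ≃ₗ[ℝ] V) : Prop :=
  ∃ lu lw : List (Fin R.r),
    R.IsReducedWordFor lu u ∧ R.IsReducedWordFor lw w ∧ lu.Sublist lw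

/-- `IsPath R [γ₁, …, γ_k] σ w` means `σ →_{γ₁} σ₁ →_{γ₂} ⋯ →_{γ_k} σ_k = w`, where
`u →_γ v` means `γ ∈ Δ₊`, `v = u s_γ` and `ℓ(v) = ℓ(u) + 1`. -/
def IsPath : List V → (V ≃ₗ[ℝ] V) → (V ≃ₗ[ℝ] V) → Prop
  | [], σ, w => σ = w
  | γ :: rest, σ, w =>
      γ ∈ R.pos ∧ R.len (σ * R.refl γ) = R.len σ + 1 ∧ IsPath rest (σ * R.refl γ) w

end RootSystemData

namespace RootSystemData

variable {V : Type*} [NormedAddCommGroup V] [InnerProductSpace ℝ V] (R : RootSystemData V)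

/-- Given a word `l = (i₁, …, i_n)` in the simple reflections and a set `P` of positions, the
product of the corresponding simple reflections taken in increasing order of position. -/
noncomputable def ascProd (l : List (Fin R.r)) (P : Finset (Fin l.length)) : V ≃ₗ[ℝ] V :=
  ((P.sort (· ≤ ·)).map (fun j => R.si (l.get j))).prod

/-- Given a word `l = (i₁, …, i_n)` in the simple reflections and a set `P` of positions, the
product of the corresponding simple reflections taken in decreasing order of position. -/
noncomputable def descProd (l : List (Fin R.r)) (P : Finset (Fin l.length)) : V ≃ₗ[ℝ] V :=
  ((P.sort (· ≤ ·)).reverse.map (fun j => R.si (l.get j))).prod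

/-- Given a reduced expression `w = s_{i₁} ⋯ s_{i_n}` (encoded by the word `l`) and positions
`J = {j₁ < ⋯ < j_k}` with `σ = s_{i_{j₁}} ⋯ s_{i_{j_k}}`, the subgroup `Γ` of `(V, +)` generated
by the roots `(s_{i_{j_k}} s_{i_{j_{k−1}}} ⋯ s_{i_{j_l}})(α_{i_m})` for all `1 ≤ l ≤ k + 1` and
all `m` with `j_{l−1} < m < j_l` (where `j₀ = 0`, `j_{k+1} = n + 1`): equivalently, for each
position `m ∉ J` the generator is obtained by applying to `α_{i_m}` the product, in decreasing
order, of the reflections at the positions of `J` beyond `m`. -/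
noncomputable def Gamma (l : List (Fin R.r)) (J : Finset (Fin l.length)) : AddSubgroup V :=
  AddSubgroup.closure
    ((fun m => R.descProd l (J.filter (fun j => m < j)) (R.α (l.get m))) '' {m | m ∉ J})

end RootSystemData

namespace RootSystemData

variable {V : Type*} [NormedAddCommGroup V] [InnerProductSpace ℝ V]

theorem si_apply_mem (R : RootSystemData V) (i : Fin R.r) {x : V} (hx : x ∈ R.Δ) :
    R.si i x ∈ R.Δ :=
  R.refl_maps _ (R.pos_subset (R.simple_mem_pos i)) x hx

theorem exists_int_si_apply (R : RootSystemData V) (i : Fin R.r) {x : V} (hx : x ∈ R.Δ) :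
    ∃ n : ℤ, R.si i x = x - n • R.α i := by
  have hα := R.pos_subset (R.simple_mem_pos i)
  obtain ⟨n, hn⟩ := R.crystallographic _ hα x hx
  exact ⟨n, by rw [si, R.refl_apply _ hα, hn, Int.cast_smul_eq_zsmul]⟩

theorem descProd_insert (R : RootSystemData V) (l : List (Fin R.r)) {a : Fin l.length}
    {P : Finset (Fin l.length)} (h : ∀ b ∈ P, a < b) :
    R.descProd l (insert a P) = R.descProd l P * R.si (l.get a) := by
  rw [descProd, Finset.sort_insert _ (fun b hb => (h b hb).le) (fun ha => (h a ha).false)]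
  simp [descProd]

/-- The subgroup generated by the roots obtained from `α_{i_m}`, for `m ∈ U \ J`, by applying the
product, in decreasing order, of the reflections at the positions of `A` beyond `m`. -/
noncomputable def closureBeyond (R : RootSystemData V) (l : List (Fin R.r))
    (J A U : Finset (Fin l.length)) : AddSubgroup V :=
  AddSubgroup.closure
    ((fun m => R.descProd l (A.filter (fun j => m < j)) (R.α (l.get m))) '' {m | m ∈ U ∧ m ∉ J})

theorem closureBeyond_congr (R : RootSystemData V) (l : List (Fin R.r))
    {J A A' U U' : Finset (Fin l.length)} (hU : ∀ m ∉ J, m ∈ U ↔ m ∈ U')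
    (hA : ∀ m ∈ U, A.filter (fun j => m < j) = A'.filter (fun j => m < j)) :
    R.closureBeyond l J A U = R.closureBeyond l J A' U' := by
  have hset : {m | m ∈ U' ∧ m ∉ J} = {m | m ∈ U ∧ m ∉ J} := by
    ext m
    exact and_congr_left fun hm => (hU m hm).symm
  rw [closureBeyond, closureBeyond, hset]
  exact congrArg _ (Set.image_congr fun m hm => by rw [hA m hm.1])

theorem closureBeyond_insert (R : RootSystemData V) (l : List (Fin R.r))
    {J A U : Finset (Fin l.length)} {a : Fin l.length} (ha : a ∉ J) :
    R.closureBeyond l J A (insert a U) =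
      AddSubgroup.closure {R.descProd l (A.filter (fun j => a < j)) (R.α (l.get a))} ⊔
        R.closureBeyond l J A U := by
  have hset : {m | m ∈ insert a U ∧ m ∉ J} = insert a {m | m ∈ U ∧ m ∉ J} := by
    ext m
    by_cases h : m = a <;> simp [h, ha]
  rw [closureBeyond, closureBeyond, hset, Set.image_insert_eq, Set.insert_eq,
    AddSubgroup.closure_union]

theorem filter_lt_insert_of_forall_lt {ι : Type*} [LinearOrder ι] {a : ι} {U : Finset ι}
    (h : ∀ b ∈ U, a < b) : (insert a U).filter (fun j => a < j) = U := by
  rw [Finset.filter_insert, if_neg (lt_irrefl a), Finset.filter_true_of_mem h]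

theorem closure_singleton_sup_eq {G : Type*} [AddCommGroup G] {x y : G} {H : AddSubgroup G}
    (h : x - y ∈ H) :
    AddSubgroup.closure {x} ⊔ H = AddSubgroup.closure {y} ⊔ H := by
  have key : ∀ {u v : G}, u - v ∈ H →
      AddSubgroup.closure {u} ⊔ H ≤ AddSubgroup.closure {v} ⊔ H := by
    intro u v huv
    refine sup_le ((AddSubgroup.closure_le _).2 (Set.singleton_subset_iff.2 ?_)) le_sup_right
    have := add_mem (AddSubgroup.mem_sup_right (S := AddSubgroup.closure {v}) huv)
      (AddSubgroup.mem_sup_left (T := H) (AddSubgroup.mem_closure_singleton_self v))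
    simpa using this
  exact le_antisymm (key h) (key (by simpa using neg_mem h))

/-- Deleting from a product of simple reflections the factors outside `J` changes the image of a
root by an element of `closureBeyond`, and does not change `closureBeyond` itself. -/
theorem closureBeyond_inter (R : RootSystemData V) (l : List (Fin R.r))
    (J U : Finset (Fin l.length)) :
    (∀ x ∈ R.Δ, R.descProd l U x - R.descProd l (U ∩ J) x ∈ R.closureBeyond l J U U) ∧
      R.closureBeyond l J (U ∩ J) U = R.closureBeyond l J U U := by
  induction U using Finset.induction_on_min with
  | empty => simp
  | insert a U h ih =>
    obtain ⟨hdiff, heq⟩ := ih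
    have hlt : ∀ b ∈ U ∩ J, a < b := fun b hb => h b (Finset.mem_inter.1 hb).1
    have hfilter : ∀ P : Finset (Fin l.length), ∀ m ∈ U,
        (insert a P).filter (fun j => m < j) = P.filter (fun j => m < j) := fun P m hm => by
      rw [Finset.filter_insert, if_neg (h m hm).not_gt]
    have hins : R.closureBeyond l J (insert a U) U = R.closureBeyond l J U U :=
      R.closureBeyond_congr l (fun _ _ => Iff.rfl) (hfilter U)
    by_cases ha : a ∈ J
    · have hU : ∀ m ∉ J, m ∈ insert a U ↔ m ∈ U := fun m hm => by
        have : m ≠ a := fun h => hm (h ▸ ha)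
        simp [this]
      have drop : ∀ A, R.closureBeyond l J A (insert a U) = R.closureBeyond l J A U := fun A =>
        R.closureBeyond_congr l hU fun _ _ => rfl
      rw [Finset.insert_inter_of_mem ha, drop, drop, hins]
      refine ⟨fun x hx => ?_, ?_⟩
      · rw [R.descProd_insert l h, R.descProd_insert l hlt]
        exact hdiff _ (R.si_apply_mem _ hx)
      · rw [R.closureBeyond_congr l (fun _ _ => Iff.rfl) (hfilter (U ∩ J)), heq]
    · rw [Finset.insert_inter_of_notMem ha, R.closureBeyond_insert l ha,
        R.closureBeyond_insert l ha, hins, heq, filter_lt_insert_of_forall_lt h,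
        Finset.filter_true_of_mem hlt]
      refine ⟨fun x hx => ?_, ?_⟩
      · obtain ⟨n, hn⟩ := R.exists_int_si_apply (l.get a) hx
        rw [R.descProd_insert l h, LinearEquiv.mul_apply, hn, map_sub, map_zsmul, sub_right_comm]
        exact sub_mem (AddSubgroup.mem_sup_right (hdiff x hx))
          (AddSubgroup.mem_sup_left (zsmul_mem (AddSubgroup.mem_closure_singleton_self _) n))
      · exact (closure_singleton_sup_eq
          (hdiff _ (R.pos_subset (R.simple_mem_pos (l.get a))))).symm

/-- Let `w = s_{i₁} ⋯ s_{i_n}` be a reduced expression, `1 ≤ j₁ < ⋯ < j_k ≤ n`,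
`σ = s_{i_{j₁}} ⋯ s_{i_{j_k}}`, and `Γ` the associated subgroup of `(V, +)`. Then `Γ` coincides
with the subgroup of `(V, +)` generated by the roots `(s_{i_n} s_{i_{n−1}} ⋯ s_{i_{m+1}})(α_{i_m})`
for those `m ∈ {1, …, n}` with `m ∉ {j₁, …, j_k}`. -/
theorem gamma_eq (R : RootSystemData V) (w : V ≃ₗ[ℝ] V) (l : List (Fin R.r))
    (hw : (l.map R.si).prod = w) (hred : l.length = R.len w)
    (J : Finset (Fin l.length)) (σ : V ≃ₗ[ℝ] V) (hσ : σ = R.ascProd l J) :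
    R.Gamma l J =
      AddSubgroup.closure
        ((fun m => R.descProd l (Finset.univ.filter (fun j => m < j)) (R.α (l.get m))) ''
          {m | m ∉ J}) := by
  simpa [closureBeyond, Gamma] using (R.closureBeyond_inter l J Finset.univ).2

end RootSystemData
end

section
/- Let A be a unital C*-algebra with A ≠ 0, let q ∈ [0,1), and let Z ∈ A satisfy 1 − Z*Z = q²(1 − ZZ*). Then ‖Z‖ = 1. -/
/-- In a complex Banach algebra, `1 - yx = c(1 - xy)` with `0 ≤ c < 1` forces `1 ∈ σ(xy)`. -/
theorem one_mem_spectrum_mul_of_one_sub_eq_smul {A : Type*} [NormedRing A] [NormedAlgebra ℂ A]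
    [CompleteSpace A] [Nontrivial A] {c : ℝ} (hc : c ∈ Set.Ico (0 : ℝ) 1) {x y : A}
    (h : 1 - y * x = (c : ℂ) • (1 - x * y)) : 1 ∈ spectrum ℂ (x * y) := by
  have swap {t : ℂ} (ht : t ≠ 0) : t ∈ spectrum ℂ (x * y) ↔ t ∈ spectrum ℂ (y * x) := by
    have := Set.ext_iff.mp (spectrum.nonzero_mul_comm (𝕜 := ℂ) x y) t
    simpa [ht] using this
  obtain rfl | hc0 := hc.1.eq_or_lt
  · have hyx : y * x = 1 := (sub_eq_zero.mp (by simpa using h)).symm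
    rw [swap one_ne_zero, hyx, spectrum.one_eq]
    rfl
  have hcC : (c : ℂ) ≠ 0 := by exact_mod_cast hc0.ne'
  have shift {s t : ℂ} (hst : 1 - s = c * (1 - t)) :
      s ∈ spectrum ℂ (y * x) ↔ t ∈ spectrum ℂ (x * y) := by
    have key : algebraMap ℂ A s - y * x = (c : ℂ) • (algebraMap ℂ A t - x * y) := by
      have hs : s = 1 - c * (1 - t) := by rw [← hst]; ring
      have hyx : y * x = 1 - (c : ℂ) • (1 - x * y) := by rw [← h]; abel
      rw [hyx, hs]
      simp only [Algebra.algebraMap_eq_smul_one]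
      module
    rw [spectrum.mem_iff, spectrum.mem_iff, key, ← Units.smul_mk0 hcC, isUnit_smul_iff]
  have hcpt := spectrum.isCompact (𝕜 := ℂ) (x * y)
  have hne := spectrum.nonempty (x * y)
  have hcont : ContinuousOn (fun t : ℂ => ‖1 - t‖) (spectrum ℂ (x * y)) := by fun_prop
  obtain ⟨s, hs, hmin⟩ := hcpt.exists_isMinOn hne hcont
  obtain ⟨t, ht, hmax⟩ := hcpt.exists_isMaxOn hne hcont
  by_contra h1
  have pos {u : ℂ} (hu : u ∈ spectrum ℂ (x * y)) : 0 < ‖1 - u‖ := by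
    rw [norm_pos_iff, sub_ne_zero]
    rintro rfl
    exact h1 hu
  have h0 : (0 : ℂ) ∈ spectrum ℂ (x * y) := by
    by_contra h0
    have ht0 : t ≠ 0 := by rintro rfl; exact h0 ht
    have hexp : 1 - t = c * (1 - (1 - (1 - t) / c)) := by field_simp; ring
    have hle := hmax ((shift hexp).mp ((swap ht0).mp ht))
    have hnorm := congrArg norm hexp
    rw [norm_mul, Complex.norm_of_nonneg hc0.le] at hnorm
    simp only [Set.mem_ofPred_eq] at hle
    nlinarith [pos ht, hc.2]
  have hcontr : 1 - (1 - c * (1 - s)) = c * (1 - s) := by ring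
  have hnorm := congrArg norm hcontr
  rw [norm_mul, Complex.norm_of_nonneg hc0.le] at hnorm
  have hs1 : ‖1 - s‖ ≤ 1 := by simpa using hmin h0
  have hfs : 1 - c * (1 - s) ≠ 0 := by
    intro hz
    rw [hz, sub_zero, norm_one] at hnorm
    nlinarith [hc.2]
  have hle := hmin ((swap hfs).mpr ((shift hcontr).mpr hs))
  simp only [Set.mem_ofPred_eq] at hle
  nlinarith [pos hs, hc.2]


/-- Let `A` be a nonzero unital C*-algebra, `q ∈ [0,1)`, and `Z ∈ A` with
`1 − Z*Z = q²(1 − ZZ*)` (the defining relation of the quantum disk algebra `C(D̄_q)`).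
Then `‖Z‖ = 1`. -/
theorem norm_eq_one_of_quantum_disk_relation {A : Type*} [NormedRing A] [StarRing A]
    [CStarRing A] [NormedAlgebra ℂ A] [CompleteSpace A] [Nontrivial A]
    (q : ℝ) (hq : q ∈ Set.Ico (0 : ℝ) 1) (Z : A)
    (hZ : 1 - star Z * Z = ((q : ℂ) ^ 2) • (1 - Z * star Z)) :
    ‖Z‖ = 1 := by
  obtain ⟨hq0, hq1⟩ := hq
  have hq2 : q ^ 2 < 1 := by nlinarith
  have hlow : 1 ≤ ‖Z‖ ^ 2 := by
    have hmem := one_mem_spectrum_mul_of_one_sub_eq_smul (c := q ^ 2) ⟨sq_nonneg q, hq2⟩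
      (x := Z) (y := star Z) (by simpa using hZ)
    simpa [CStarRing.norm_self_mul_star, sq] using spectrum.norm_le_norm_of_mem hmem
  have hup : ‖Z‖ ^ 2 ≤ (1 - q ^ 2) + q ^ 2 * ‖Z‖ ^ 2 := by
    have hZ' : star Z * Z = ((1 - q ^ 2 : ℝ) : ℂ) • 1 + ((q ^ 2 : ℝ) : ℂ) • (Z * star Z) := by
      rw [← sub_sub_cancel 1 (star Z * Z), hZ]
      push_cast
      module
    calc ‖Z‖ ^ 2 = ‖star Z * Z‖ := by rw [CStarRing.norm_star_mul_self, sq]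
      _ ≤ _ := by
        rw [hZ']
        refine (norm_add_le _ _).trans_eq ?_
        rw [norm_smul, norm_smul, CStarRing.norm_self_mul_star, CStarRing.norm_one,
          Complex.norm_of_nonneg (sub_nonneg.mpr hq2.le), Complex.norm_of_nonneg (sq_nonneg q)]
        ring
  have hsq : ‖Z‖ ^ 2 = 1 := le_antisymm (by nlinarith) hlow
  exact (pow_eq_one_iff_of_nonneg (norm_nonneg Z) two_ne_zero).mp hsq
end

section
/- Let A be a unital C*-algebra and Q ∈ A a self-adjoint element of the center of A. For each q ∈ ℝ let I_q ⊆ A be the closed two-sided ideal generated by Q − q·1, and let π_q : A → A/I_q be the quotient map onto the quotient C*-algebra. Then for every a ∈ A the function ℝ → ℝ, q ↦ ‖π_q(a)‖, is upper semicontinuous. -/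
/-- The two-sided ideal generated by `g` in a unital ring: the set of finite sums
`Σ_i x_i * g * y_i`. -/
def twoSidedIdealGen {A : Type*} [Ring A] (g : A) : Set A :=
  {z | ∃ (n : ℕ) (x y : Fin n → A), z = ∑ i, x i * g * y i}

/-- Let `A` be a unital C*-algebra and `Q ∈ A` a self-adjoint element of the center of `A`.
For `q ∈ ℝ` let `I_q` be the closed two-sided ideal generated by `Q − q·1` and `π_q` the
quotient map onto `A/I_q`, so that `‖π_q(a)‖ = inf {‖a + x‖ : x ∈ I_q}`.  Then for every
`a ∈ A` the function `q ↦ ‖π_q(a)‖` is upper semicontinuous. -/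
theorem upperSemicontinuous_quotient_norm {A : Type*} [NormedRing A] [StarRing A]
    [CStarRing A] [NormedAlgebra ℂ A] [CompleteSpace A]
    (Q : A) (hQsa : IsSelfAdjoint Q) (hQcentral : ∀ x : A, Q * x = x * Q) (a : A) :
    UpperSemicontinuous fun q : ℝ =>
      sInf ((fun x => ‖a + x‖) '' closure (twoSidedIdealGen (Q - (q : ℂ) • 1))) := by
  intro q c hc
  have hne : (closure (twoSidedIdealGen (Q - (q : ℂ) • 1))).Nonempty :=
    ⟨0, subset_closure ⟨0, 0, 0, by simp⟩⟩
  obtain ⟨_, ⟨x, hx, rfl⟩, hxc⟩ := exists_lt_of_csInf_lt (hne.image _) hc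
  have hopen : IsOpen {x : A | ‖a + x‖ < c} := isOpen_lt (by fun_prop) continuous_const
  obtain ⟨_, hzc, n, u, v, rfl⟩ := mem_closure_iff.1 hx _ hopen hxc
  have hcont : Continuous fun p : ℝ => ‖a + ∑ i, u i * (Q - (p : ℂ) • 1) * v i‖ := by
    fun_prop
  filter_upwards [hcont.continuousAt.eventually_lt continuousAt_const hzc] with p hp
  have hmem : ∑ i, u i * (Q - (p : ℂ) • 1) * v i ∈ twoSidedIdealGen (Q - (p : ℂ) • 1) :=
    ⟨n, u, v, rfl⟩
  refine (csInf_le ⟨0, ?_⟩ (Set.mem_image_of_mem _ (subset_closure hmem))).trans_lt hp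
  rintro _ ⟨y, -, rfl⟩
  exact norm_nonneg _
end
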